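/- Let A, B ∈ T^m(ℂⁿ) and let (λ, u) be a CB-eigenpair of (A,B), i.e., u ≠ 0 and u ∘ (A u^{m−1} − λ B u^{m−1}) = 0. Let J = {j : u_j ≠ 0}. Then the subvector u_J is a generalized eigenvector of the principal sub-tensor pair (A_J, B_J) with eigenvalue λ, i.e., A_J (u_J)^{m−1} − λ B_J (u_J)^{m−1} = 0. -/

import Mathlib

open Finset

attribute [local instance] Classical.propDecidable

/-- `(A x^{m-1})_i` for an (m+1)-th order tensor over a finite index type `ι`. -/
noncomputable def tvecC {ι : Type*} [Fintype ι] {m : ℕ} (A : (Fin (m + 1) → ι) → ℂ) (x : ι → ℂ)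
    (i : ι) : ℂ :=
  ∑ g : Fin m → ι, A (Fin.cons i g) * ∏ j, x (g j)

theorem tvecC_restrict {n m : ℕ} (A : (Fin (m + 1) → Fin n) → ℂ) (u : Fin n → ℂ)
    (j : {j : Fin n // u j ≠ 0}) :
    tvecC (fun f : Fin (m + 1) → {j : Fin n // u j ≠ 0} => A (fun k => (f k).1))
      (fun j => u j.1) j = tvecC A u j.1 := by
  unfold tvecC
  refine Finset.sum_of_injOn (fun g k => (g k).1) ?_ ?_ ?_ ?_
  · intro g _ h _ hgh
    funext k
    exact Subtype.ext (congrFun hgh k)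
  · intro g _
    simp
  · intro g _ hg
    have hex : ∃ k, u (g k) = 0 := by
      by_contra hne
      apply hg
      refine ⟨fun k => ⟨g k, fun h0 => hne ⟨k, h0⟩⟩, by simp, rfl⟩
    obtain ⟨k, hk⟩ := hex
    rw [Finset.prod_eq_zero (Finset.mem_univ k) hk, mul_zero]
  · intro g _
    have hc : (fun k => ((Fin.cons j g : Fin (m + 1) → {j : Fin n // u j ≠ 0}) k).1)
        = (Fin.cons j.1 (fun k => (g k).1) : Fin (m + 1) → Fin n) := by
      funext k
      refine Fin.cases ?_ (fun k => ?_) k <;> simp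
    simp only [hc]

/-- if `(λ, u)` is a CB-eigenpair of `(A,B)` (`u ≠ 0` and
`u ∘ (A u^{m-1} - λ B u^{m-1}) = 0`) and `J = {j : u_j ≠ 0}`, then
`A_J (u_J)^{m-1} - λ B_J (u_J)^{m-1} = 0`, i.e. `u_J` is a generalized eigenvector of
the principal sub-tensor pair `(A_J, B_J)` with eigenvalue `λ`. -/
theorem stmt_6 {n m : ℕ} (A B : (Fin (m + 1) → Fin n) → ℂ) (lam : ℂ) (u : Fin n → ℂ)
    (hu : u ≠ 0)
    (heig : ∀ i, u i * (tvecC A u i - lam * tvecC B u i) = 0) :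
    ∀ j : {j : Fin n // u j ≠ 0},
      tvecC (fun f : Fin (m + 1) → {j : Fin n // u j ≠ 0} => A (fun k => (f k).1))
          (fun j => u j.1) j
        - lam * tvecC (fun f : Fin (m + 1) → {j : Fin n // u j ≠ 0} => B (fun k => (f k).1))
            (fun j => u j.1) j = 0 := by
  intro j
  rw [tvecC_restrict A u j, tvecC_restrict B u j]
  exact (mul_eq_zero.mp (heig j.1)).resolve_left j.2
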